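/- Let L be the generator of a C₀-semigroup (e^{tL})_{t≥0} of contractions on a Hilbert space such that the entire imaginary axis iℝ is contained in the resolvent set ρ(L), and let l be a positive integer. Then there exists a constant C > 0 such that ‖e^{tL} U₀‖ ≤ C t^{−1/l} ‖U₀‖_{D(L)} for all U₀ ∈ D(L) and all t > 1, and also ‖e^{tL} U₀‖ ≤ C t^{−1} ‖U₀‖_{D(L^l)} for all U₀ ∈ D(L^l) and all t > 1, if and only if limsup_{|β|→∞} |β|^{−l} ‖(iβ − L)^{−1}‖ < ∞. -/

import Mathlib

open MeasureTheory Set Filter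
open scoped Topology

noncomputable section

open scoped FourierTransform ContDiff InnerProductSpace

theorem toLp_fourier_ae_eq {X : Type*} [NormedAddCommGroup X] [InnerProductSpace ℂ X]
    [CompleteSpace X] {f : ℝ → X} (h1 : Integrable f) (h2 : MemLp f 2) :
    (𝓕 (h2.toLp f) : Lp X 2 (volume : Measure ℝ)) =ᵐ[volume] 𝓕 f := by
  have hcont : Continuous (𝓕 f) :=
    VectorFourier.fourierIntegral_continuous Real.continuous_fourierChar
      (by exact continuous_inner) h1
  refine ae_eq_of_integral_contDiff_smul_eq
    ((Lp.memLp _).locallyIntegrable (by norm_num)) hcont.locallyIntegrable fun g hg hgc => ?_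
  have hg₁ : HasCompactSupport (Complex.ofRealCLM ∘ g) := hgc.comp_left rfl
  have hg₂ : ContDiff ℝ ∞ (Complex.ofRealCLM ∘ g) := by fun_prop
  set φ := hg₁.toSchwartzMap hg₂ with hφ
  have hφa : ∀ x, φ x = (g x : ℂ) := fun x => rfl
  have key := congrArg (fun u => u φ) (Lp.fourier_toTemperedDistribution_eq (h2.toLp f))
  simp only [TemperedDistribution.fourier_apply, Lp.toTemperedDistribution_apply] at key
  have hl : ∫ x, (𝓕 φ) x • (h2.toLp f) x = ∫ x, (𝓕 (φ : ℝ → ℂ)) x • f x := by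
    refine integral_congr_ae ?_
    filter_upwards [h2.coeFn_toLp] with x hx
    rw [hx, SchwartzMap.fourier_coe]
  have hr := VectorFourier.integral_fourierIntegral_smul_eq_flip (μ := volume) (ν := volume)
    (L := innerₗ ℝ) Real.continuous_fourierChar (by exact continuous_inner) φ.integrable h1
  rw [flip_innerₗ] at hr
  have hr' : ∫ x, (𝓕 (φ : ℝ → ℂ)) x • f x = ∫ x, φ x • (𝓕 f) x := hr
  rw [hl, hr'] at key
  simpa [hφa, Complex.coe_smul] using key.symm

theorem integral_norm_sq_le_of_fourier_le {X : Type*} [NormedAddCommGroup X]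
    [InnerProductSpace ℂ X] [CompleteSpace X] {f g : ℝ → X} (hf1 : Integrable f)
    (hf2 : MemLp f 2) (hg1 : Integrable g) (hg2 : MemLp g 2) {c : ℝ}
    (h : ∀ w, ‖𝓕 g w‖ ≤ c * ‖𝓕 f w‖) :
    ∫ t, ‖g t‖ ^ 2 ≤ c ^ 2 * ∫ t, ‖f t‖ ^ 2 := by
  have hnorm : ∀ {u : ℝ → X} (hu : MemLp u 2), ∫ t, ‖u t‖ ^ 2 = ‖hu.toLp u‖ ^ 2 := by
    intro u hu
    rw [← inner_self_eq_norm_sq (𝕜 := ℂ), L2.inner_def, ← integral_re (L2.integrable_inner _ _)]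
    refine integral_congr_ae ?_
    filter_upwards [hu.coeFn_toLp] with t ht
    rw [ht, inner_self_eq_norm_sq (𝕜 := ℂ)]
  rw [hnorm hf2, hnorm hg2, ← mul_pow]
  refine pow_le_pow_left₀ (norm_nonneg _) ?_ 2
  rw [← Lp.norm_fourier_eq (hf2.toLp f), ← Lp.norm_fourier_eq (hg2.toLp g)]
  refine Lp.norm_le_mul_norm_of_ae_le_mul ?_
  filter_upwards [toLp_fourier_ae_eq hf1 hf2, toLp_fourier_ae_eq hg1 hg2] with w hw1 hw2
  rw [hw1, hw2]
  exact h w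

theorem integrableOn_Ioi_of_exp_bound {X : Type*} [NormedAddCommGroup X] [NormedSpace ℝ X]
    {f : ℝ → X} (hf : ContinuousOn f (Ici 0)) {C a : ℝ} (ha : 0 < a)
    (hb : ∀ t, 0 ≤ t → ‖f t‖ ≤ C * Real.exp (-a * t)) : IntegrableOn f (Ioi 0) := by
  refine Integrable.mono' ((integrableOn_exp_mul_Ioi (neg_lt_zero.2 ha) 0).const_mul C)
    ((hf.mono Ioi_subset_Ici_self).aestronglyMeasurable measurableSet_Ioi) ?_
  filter_upwards [ae_restrict_mem measurableSet_Ioi] with t ht using hb t (le_of_lt ht)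

theorem memLp_two_indicator_Ioi_of_exp_bound {X : Type*} [NormedAddCommGroup X] [NormedSpace ℝ X]
    {f : ℝ → X} (hf : ContinuousOn f (Ici 0)) {C a : ℝ} (ha : 0 < a)
    (hb : ∀ t, 0 ≤ t → ‖f t‖ ≤ C * Real.exp (-a * t)) :
    MemLp ((Ioi 0).indicator f) 2 := by
  rw [memLp_indicator_iff_restrict measurableSet_Ioi,
    memLp_two_iff_integrable_sq_norm
      ((hf.mono Ioi_subset_Ici_self).aestronglyMeasurable measurableSet_Ioi)]
  refine integrableOn_Ioi_of_exp_bound (C := C ^ 2) (a := 2 * a) (hf.norm.pow 2)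
    (by positivity) fun t ht => ?_
  have := pow_le_pow_left₀ (norm_nonneg _) (hb t ht) 2
  rw [norm_pow, norm_norm]
  refine this.trans_eq ?_
  rw [mul_pow, ← Real.exp_nat_mul]
  congr 2
  push_cast
  ring

theorem integral_Ioi_of_hasDeriv_right {X : Type*} [NormedAddCommGroup X] [NormedSpace ℝ X]
    [CompleteSpace X] {u u' : ℝ → X} (hu : ContinuousOn u (Ici 0))
    (hd : ∀ t, 0 < t → HasDerivWithinAt u (u' t) (Ioi t) t) (hi : IntegrableOn u' (Ioi 0))
    (h0 : Tendsto u atTop (𝓝 0)) : ∫ t in Ioi 0, u' t = - u 0 := by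
  refine tendsto_nhds_unique (intervalIntegral_tendsto_integral_Ioi 0 hi tendsto_id) ?_
  have h : Tendsto (fun t => u t - u 0) atTop (𝓝 (0 - u 0)) := h0.sub_const _
  rw [zero_sub] at h
  refine h.congr' ?_
  filter_upwards [eventually_ge_atTop 0] with t ht
  refine (intervalIntegral.integral_eq_sub_of_hasDeriv_right ?_ ?_ ?_).symm
  · rw [uIcc_of_le ht]; exact hu.mono Icc_subset_Ici_self
  · intro s hs
    rw [min_eq_left (show (0 : ℝ) ≤ t from ht)] at hs
    exact hd s hs.1
  · rw [intervalIntegrable_iff, uIoc_of_le ht]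
    exact hi.mono_set Ioc_subset_Ioi_self

theorem tendsto_zero_of_exp_bound {X : Type*} [NormedAddCommGroup X] {u : ℝ → X} {C a : ℝ} (ha : 0 < a)
    (hb : ∀ t, 0 ≤ t → ‖u t‖ ≤ C * Real.exp (-a * t)) : Tendsto u atTop (𝓝 0) := by
  refine squeeze_zero_norm' (a := fun t => C * Real.exp (-a * t))
    ((eventually_ge_atTop 0).mono hb) ?_
  rw [← mul_zero C]
  refine (Real.tendsto_exp_atBot.comp ?_).const_mul C
  exact tendsto_id.const_mul_atTop_of_neg (neg_lt_zero.2 ha)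

theorem norm_exp_neg_mul (z : ℂ) (t : ℝ) :
    ‖Complex.exp (-z * t)‖ = Real.exp (-z.re * t) := by
  rw [Complex.norm_exp]; simp

theorem mul_exp_neg_le {a t : ℝ} (ha : 0 < a) :
    t * Real.exp (-a * t) ≤ 2 / a * Real.exp (-(a / 2) * t) := by
  have h1 : t ≤ 2 / a * Real.exp (a / 2 * t) := by
    have := Real.add_one_le_exp (a / 2 * t)
    rw [div_mul_eq_mul_div, le_div_iff₀ ha]
    linarith
  have h2 : Real.exp (-(a / 2) * t) = Real.exp (a / 2 * t) * Real.exp (-a * t) := by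
    rw [← Real.exp_add]; congr 1; ring
  rw [h2, ← mul_assoc]
  gcongr

/-- `T` is a contraction `C₀`-semigroup with generator `L` on the domain `D`. -/
structure GeneratesContractions {X : Type*} [NormedAddCommGroup X] [InnerProductSpace ℂ X]
    (T : ℝ → X →L[ℂ] X) (D : Submodule ℂ X) (L : X →ₗ[ℂ] X) : Prop where
  zero : T 0 = 1
  semigroup : ∀ s t : ℝ, 0 ≤ s → 0 ≤ t → T (s + t) = T s ∘L T t
  cont : ∀ x : X, ContinuousOn (fun t => T t x) (Ici 0)
  contr : ∀ t : ℝ, 0 ≤ t → ‖T t‖ ≤ 1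
  deriv : ∀ x ∈ D, HasDerivWithinAt (fun t => T t x) (L x) (Ici 0) 0
  dom : ∀ x : X, (∃ y : X, HasDerivWithinAt (fun t => T t x) y (Ici 0) 0) → x ∈ D

/-- `S` is the inverse of `z - L`, where `L` has domain `D`. -/
def IsResolventAt {X : Type*} [NormedAddCommGroup X] [InnerProductSpace ℂ X]
    (D : Submodule ℂ X) (L : X →ₗ[ℂ] X) (z : ℂ) (S : X →L[ℂ] X) : Prop :=
  (∀ y : X, S y ∈ D) ∧ (∀ y : X, z • S y - L (S y) = y) ∧ ∀ x ∈ D, S (z • x - L x) = x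

section Resolvent

variable {X : Type*} [NormedAddCommGroup X] [InnerProductSpace ℂ X]
  {D : Submodule ℂ X} {L : X →ₗ[ℂ] X}

theorem IsResolventAt.identity {z w : ℂ} {S S' : X →L[ℂ] X} (hS : IsResolventAt D L z S)
    (hS' : IsResolventAt D L w S') (y : X) : S y + (z - w) • S (S' y) = S' y := by
  have h := hS.2.2 _ (hS'.1 y)
  have h2 : z • S' y - L (S' y) = y + (z - w) • S' y := by
    nth_rewrite 3 [← hS'.2.1 y]
    module
  rw [h2, map_add, map_smul] at h
  exact h

theorem IsResolventAt.norm_le_of_near {z w : ℂ} {S S' : X →L[ℂ] X}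
    (hS : IsResolventAt D L z S) (hS' : IsResolventAt D L w S')
    (hzw : ‖z - w‖ * ‖S'‖ ≤ 1 / 2) : ‖S‖ ≤ 2 * ‖S'‖ := by
  have h : S = S' - (z - w) • (S ∘L S') := by
    ext y
    have := hS.identity hS' y
    exact eq_sub_of_add_eq this
  have h1 : ‖S‖ ≤ ‖S'‖ + ‖z - w‖ * (‖S‖ * ‖S'‖) := by
    conv_lhs => rw [h]
    refine (norm_sub_le _ _).trans ?_
    rw [norm_smul]
    gcongr
    exact ContinuousLinearMap.opNorm_comp_le _ _
  nlinarith [mul_le_mul_of_nonneg_left hzw (norm_nonneg S)]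

theorem exists_bound_resolvent_on_Icc {R : ℝ → X →L[ℂ] X}
    (hR : ∀ β : ℝ, IsResolventAt D L (Complex.I * β) (R β)) (b : ℝ) :
    ∃ K, ∀ β ∈ Icc (-b) b, ‖R β‖ ≤ K := by
  refine isCompact_Icc.induction_on (p := fun s => ∃ K, ∀ β ∈ s, ‖R β‖ ≤ K) ⟨0, by simp⟩
    (fun s t hst ⟨K, hK⟩ => ⟨K, fun β hβ => hK β (hst hβ)⟩) ?_ fun γ _ => ?_
  · rintro s t ⟨K, hK⟩ ⟨K', hK'⟩
    refine ⟨max K K', ?_⟩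
    rintro β (hβ | hβ)
    · exact (hK β hβ).trans (le_max_left _ _)
    · exact (hK' β hβ).trans (le_max_right _ _)
  · have hpos : 0 < 1 / (2 * (‖R γ‖ + 1)) := by positivity
    refine ⟨Metric.ball γ (1 / (2 * (‖R γ‖ + 1))),
      mem_nhdsWithin_of_mem_nhds (Metric.ball_mem_nhds _ hpos), 2 * ‖R γ‖, fun β hβ => ?_⟩
    refine (hR β).norm_le_of_near (hR γ) ?_
    have hd : ‖(Complex.I * β - Complex.I * γ : ℂ)‖ = dist β γ := by
      rw [← mul_sub, norm_mul, Complex.norm_I, one_mul, ← Complex.ofReal_sub,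
        Complex.norm_real, Real.dist_eq, Real.norm_eq_abs]
    rw [hd]
    have h1 := (Metric.mem_ball.1 hβ).le
    calc dist β γ * ‖R γ‖ ≤ 1 / (2 * (‖R γ‖ + 1)) * (‖R γ‖ + 1) := by gcongr; linarith
      _ = 1 / 2 := by field_simp

theorem exists_bound_resolvent_mul_pow {R : ℝ → X →L[ℂ] X}
    (hR : ∀ β : ℝ, IsResolventAt D L (Complex.I * β) (R β)) {l : ℕ} {M β₀ : ℝ}
    (hM : ∀ β : ℝ, β₀ ≤ |β| → ‖R β‖ ≤ M * |β| ^ l) :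
    ∃ K, 0 < K ∧ ∀ β, ‖R β * R 0 ^ l‖ ≤ K := by
  set b := max β₀ 1
  have hlarge : ∀ k ≤ l, ∃ K, ∀ β : ℝ, b ≤ |β| → ‖R β * R 0 ^ k‖ ≤ K * |β| ^ (l - k) := by
    intro k
    induction k with
    | zero =>
      exact fun _ => ⟨M, fun β hβ => by simpa using hM β ((le_max_left _ _).trans hβ)⟩
    | succ k ih =>
      intro hk
      obtain ⟨K, hK⟩ := ih (by omega)
      refine ⟨K + ‖R 0 ^ (k + 1)‖, fun β hβ => ?_⟩
      have hβ1 : 1 ≤ |β| := (le_max_right _ _).trans hβ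
      have hid : (Complex.I * β) • (R β * R 0 ^ (k + 1)) = R 0 ^ (k + 1) - R β * R 0 ^ k := by
        ext y
        have := (hR β).identity (hR 0) ((R 0 ^ k) y)
        rw [pow_succ']
        simp only [Complex.ofReal_zero, mul_zero, sub_zero] at this
        exact eq_sub_of_add_eq' this
      have hn : |β| * ‖R β * R 0 ^ (k + 1)‖ ≤ ‖R 0 ^ (k + 1)‖ + ‖R β * R 0 ^ k‖ := by
        have := norm_sub_le (R 0 ^ (k + 1)) (R β * R 0 ^ k)
        rw [← hid, norm_smul] at this
        simpa using this
      have hp : |β| ^ (l - k) = |β| * |β| ^ (l - (k + 1)) := by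
        rw [← pow_succ']; congr 1; omega
      have h3 := hK β hβ
      rw [hp] at h3
      have h1 : 1 ≤ |β| * |β| ^ (l - (k + 1)) := one_le_mul_of_one_le_of_one_le hβ1
        (one_le_pow₀ hβ1)
      have h4 := mul_le_mul_of_nonneg_left h1 (norm_nonneg (R 0 ^ (k + 1)))
      refine le_of_mul_le_mul_left ?_ (zero_lt_one.trans_le hβ1)
      linarith
  obtain ⟨K, hK⟩ := hlarge l le_rfl
  obtain ⟨K', hK'⟩ := exists_bound_resolvent_on_Icc hR b
  refine ⟨max (max K (K' * ‖R 0 ^ l‖)) 1, lt_max_of_lt_right one_pos, fun β => ?_⟩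
  refine le_trans ?_ (le_max_left _ _)
  rcases le_total b |β| with h | h
  · exact le_trans (by simpa using hK β h) (le_max_left _ _)
  · refine ((norm_mul_le _ _).trans ?_).trans (le_max_right _ _)
    gcongr
    exact hK' β (abs_le.1 h)

theorem norm_sq_le_of_accretive {S : X →L[ℂ] X} (hS : ∀ y, 0 ≤ (⟪y, S y⟫_ℂ).re) (y : X) :
    ‖S y‖ ^ 2 ≤ 6 * (‖y‖ * ‖S (S y)‖) := by
  rcases (norm_nonneg (S y)).eq_or_lt with hq | hq
  · rw [← hq, zero_pow two_ne_zero]; positivity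
  have hp : 0 < ‖y‖ := by
    rw [norm_pos_iff]; rintro rfl; simp at hq
  set p := ‖y‖
  set q := ‖S y‖
  set r := ‖S (S y)‖
  have main : ∀ a : ℝ, 0 < a → a * q ^ 2 ≤ p * q + a * (p * r) + a ^ 2 * (q * r) := by
    intro a ha
    have h := hS (y - (a : ℂ) • S y)
    have e1 := (Complex.abs_re_le_norm _).trans (norm_inner_le_norm (𝕜 := ℂ) y (S y))
    have e2 := (Complex.abs_re_le_norm _).trans (norm_inner_le_norm (𝕜 := ℂ) y (S (S y)))
    have e3 := (Complex.abs_re_le_norm _).trans (norm_inner_le_norm (𝕜 := ℂ) (S y) (S (S y)))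
    have e4 : (⟪S y, S y⟫_ℂ).re = q ^ 2 := inner_self_eq_norm_sq (𝕜 := ℂ) (S y)
    simp only [map_sub, map_smul, inner_sub_left, inner_sub_right, inner_smul_left,
      inner_smul_right, Complex.conj_ofReal, Complex.sub_re, Complex.re_ofReal_mul, e4] at h
    have f2 := mul_le_mul_of_nonneg_left (neg_le_of_abs_le e2) ha.le
    have f3 := mul_le_mul_of_nonneg_left (le_of_abs_le e3) (sq_nonneg a)
    have f1 := le_of_abs_le e1
    simp only [p, q, r]
    nlinarith
  have h := main (2 * p / q) (by positivity)
  have e : 2 * p / q * q ^ 2 = 2 * p * q := by field_simp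
  have e' : 2 * p / q * (p * r) + (2 * p / q) ^ 2 * (q * r) = p * (6 * (p * r)) / q := by
    field_simp; ring
  rw [e, add_assoc, e'] at h
  have h2 : p * q ≤ p * (6 * (p * r)) / q := by linarith
  rw [le_div_iff₀ hq] at h2
  refine le_of_mul_le_mul_left ?_ hp
  linarith

theorem exists_norm_pow_le_of_accretive {S : X →L[ℂ] X} (hS : ∀ y, 0 ≤ (⟪y, S y⟫_ℂ).re) (k : ℕ) :
    ∃ c, 0 < c ∧ ∀ y, ‖S y‖ ^ (k + 1) ≤ c * ‖y‖ ^ k * ‖(S ^ (k + 1)) y‖ := by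
  induction k with
  | zero => exact ⟨1, one_pos, by simp⟩
  | succ k ih =>
    obtain ⟨c, hc, ih⟩ := ih
    refine ⟨6 ^ (k + 1) * c, by positivity, fun y => ?_⟩
    rcases (norm_nonneg (S y)).eq_or_lt with hq | hq
    · rw [← hq]; simp; positivity
    have h1 := pow_le_pow_left₀ (by positivity) (norm_sq_le_of_accretive hS y) (k + 1)
    have h2 := ih (S y)
    have e : (S ^ (k + 1 + 1)) y = (S ^ (k + 1)) (S y) := by rw [pow_succ]; rfl
    rw [e]
    refine le_of_mul_le_mul_left ?_ (pow_pos hq k)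
    calc ‖S y‖ ^ k * ‖S y‖ ^ (k + 1 + 1) = (‖S y‖ ^ 2) ^ (k + 1) := by ring
      _ ≤ (6 * (‖y‖ * ‖S (S y)‖)) ^ (k + 1) := h1
      _ = 6 ^ (k + 1) * ‖y‖ ^ (k + 1) * ‖S (S y)‖ ^ (k + 1) := by rw [mul_pow, mul_pow]; ring
      _ ≤ 6 ^ (k + 1) * ‖y‖ ^ (k + 1) * (c * ‖S y‖ ^ k * ‖(S ^ (k + 1)) (S y)‖) := by gcongr
      _ = _ := by ring

end Resolvent

namespace GeneratesContractions

variable {X : Type*} [NormedAddCommGroup X] [InnerProductSpace ℂ X]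
  {T : ℝ → X →L[ℂ] X} {D : Submodule ℂ X} {L : X →ₗ[ℂ] X}

theorem norm_apply_le (h : GeneratesContractions T D L) {t : ℝ} (ht : 0 ≤ t) (x : X) :
    ‖T t x‖ ≤ ‖x‖ := by
  simpa using (T t).le_of_opNorm_le (h.contr t ht) x

theorem norm_apply_anti (h : GeneratesContractions T D L) {s t : ℝ} (hs : 0 ≤ s) (hst : s ≤ t)
    (x : X) : ‖T t x‖ ≤ ‖T s x‖ := by
  have e : T t x = T (t - s) (T s x) := by
    rw [← ContinuousLinearMap.comp_apply, ← h.semigroup _ _ (sub_nonneg.2 hst) hs, sub_add_cancel]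
  rw [e]
  exact h.norm_apply_le (sub_nonneg.2 hst) _

theorem apply_comm (h : GeneratesContractions T D L) {s t : ℝ} (hs : 0 ≤ s) (ht : 0 ≤ t)
    (x : X) : T s (T t x) = T t (T s x) := by
  rw [← ContinuousLinearMap.comp_apply, ← h.semigroup s t hs ht, add_comm, h.semigroup t s ht hs]
  rfl

theorem hasDerivWithinAt_zero_apply (h : GeneratesContractions T D L) {t : ℝ} (ht : 0 ≤ t)
    {x : X} (hx : x ∈ D) :
    HasDerivWithinAt (fun s => T s (T t x)) (T t (L x)) (Ici 0) 0 := by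
  have h1 : HasDerivWithinAt (fun s => T t (T s x)) (T t (L x)) (Ici 0) 0 :=
    ((T t).restrictScalars ℝ).hasFDerivAt.comp_hasDerivWithinAt (0 : ℝ) (h.deriv x hx)
  exact h1.congr (fun s hs => h.apply_comm hs ht x) (h.apply_comm le_rfl ht x)

theorem apply_mem (h : GeneratesContractions T D L) {t : ℝ} (ht : 0 ≤ t) {x : X} (hx : x ∈ D) :
    T t x ∈ D :=
  h.dom _ ⟨_, h.hasDerivWithinAt_zero_apply ht hx⟩

theorem generator_apply (h : GeneratesContractions T D L) {t : ℝ} (ht : 0 ≤ t) {x : X}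
    (hx : x ∈ D) : L (T t x) = T t (L x) :=
  (uniqueDiffOn_Ici (0 : ℝ) 0 self_mem_Ici).eq_deriv _ (h.deriv _ (h.apply_mem ht hx))
    (h.hasDerivWithinAt_zero_apply ht hx)

theorem resolvent_apply (h : GeneratesContractions T D L) {t : ℝ} (ht : 0 ≤ t) {z : ℂ}
    {S : X →L[ℂ] X} (hS : IsResolventAt D L z S) (y : X) : S (T t y) = T t (S y) := by
  have h1 := hS.2.2 _ (h.apply_mem ht (hS.1 y))
  rw [h.generator_apply ht (hS.1 y), ← map_smul, ← map_sub, hS.2.1] at h1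
  exact h1

theorem pow_apply (h : GeneratesContractions T D L) {t : ℝ} (ht : 0 ≤ t) {z : ℂ}
    {S : X →L[ℂ] X} (hS : IsResolventAt D L z S) (k : ℕ) (y : X) :
    (S ^ k) (T t y) = T t ((S ^ k) y) := by
  induction k generalizing y with
  | zero => rfl
  | succ k ih =>
    rw [pow_succ, mul_apply_eq_comp, mul_apply_eq_comp,
      h.resolvent_apply ht hS, ih]

theorem hasDerivWithinAt_apply (h : GeneratesContractions T D L) {t : ℝ} (ht : 0 ≤ t)
    {x : X} (hx : x ∈ D) : HasDerivWithinAt (fun s => T s x) (T t (L x)) (Ici t) t := by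
  have h0 := h.hasDerivWithinAt_zero_apply ht hx
  have h1 : HasDerivWithinAt (fun s : ℝ => s - t) 1 (Ici t) t :=
    ((hasDerivAt_id t).sub_const t).hasDerivWithinAt
  have h2 := HasDerivWithinAt.scomp_of_eq t h0 h1 (fun s hs => mem_Ici.2 (sub_nonneg.2 hs))
    (sub_self t).symm
  rw [one_smul] at h2
  have e : ∀ s ∈ Ici t, T s x = ((fun s => T s (T t x)) ∘ fun s => s - t) s := fun s hs => by
    have := h.semigroup (s - t) t (sub_nonneg.2 hs) ht
    rw [sub_add_cancel] at this
    rw [this]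
    rfl
  exact h2.congr e (e t self_mem_Ici)

theorem hasDerivWithinAt_exp_smul (h : GeneratesContractions T D L) {t : ℝ} (ht : 0 ≤ t)
    {x : X} (hx : x ∈ D) (z : ℂ) :
    HasDerivWithinAt (fun s : ℝ => Complex.exp (-z * s) • T s x)
      (-(Complex.exp (-z * t) • T t (z • x - L x))) (Ici t) t := by
  have h1 : HasDerivAt (fun s : ℝ => Complex.exp (-z * s)) (Complex.exp (-z * t) * (-z * 1)) t :=
    ((hasDerivAt_id t).ofReal_comp.const_mul (-z)).cexp
  have h2 := h1.hasDerivWithinAt.smul (h.hasDerivWithinAt_apply ht hx)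
  refine h2.congr_deriv ?_
  simp only [map_sub, map_smul]
  module

theorem re_inner_generator_nonpos (h : GeneratesContractions T D L) {x : X} (hx : x ∈ D) :
    (⟪x, L x⟫_ℂ).re ≤ 0 := by
  have h1 := (((innerSL ℂ x).restrictScalars ℝ).hasFDerivAt.comp_hasDerivWithinAt (0 : ℝ)
    (h.deriv x hx))
  have h2 := Complex.reCLM.hasFDerivAt.comp_hasDerivWithinAt (0 : ℝ) h1
  have h3 := (hasDerivWithinAt_iff_tendsto_slope' (by simp)).1 (h2.mono Ioi_subset_Ici_self)
  refine le_of_tendsto h3 ?_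
  filter_upwards [self_mem_nhdsWithin] with t ht
  have e : (⟪x, T t x⟫_ℂ).re ≤ (⟪x, T 0 x⟫_ℂ).re := by
    rw [h.zero]
    have e4 : (⟪x, x⟫_ℂ).re = ‖x‖ ^ 2 := inner_self_eq_norm_sq (𝕜 := ℂ) x
    refine (((Complex.re_le_norm _).trans (norm_inner_le_norm (𝕜 := ℂ) x _)).trans
      (mul_le_mul_of_nonneg_left (h.norm_apply_le (le_of_lt ht) x) (norm_nonneg x))).trans_eq ?_
    rw [one_apply_eq_self, e4, sq]
  rw [slope_def_field]
  refine div_nonpos_of_nonpos_of_nonneg ?_ (by simpa using (le_of_lt ht))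
  simpa using e

theorem re_inner_resolvent_nonneg (h : GeneratesContractions T D L) {S : X →L[ℂ] X}
    (hS : IsResolventAt D L 0 S) (y : X) : 0 ≤ (⟪y, S y⟫_ℂ).re := by
  have h1 := h.re_inner_generator_nonpos (hS.1 y)
  have h2 := hS.2.1 y
  rw [zero_smul, zero_sub, neg_eq_iff_eq_neg] at h2
  rw [h2, inner_neg_right, Complex.neg_re, ← inner_conj_symm, Complex.conj_re] at h1
  linarith

/-- The decay of orbits starting in the domain bounds the resolvent. -/
theorem norm_le_of_decay (h : GeneratesContractions T D L) {t : ℝ} (ht : 0 ≤ t) {x : X}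
    (hx : x ∈ D) (β : ℝ) :
    ‖x‖ ≤ ‖T t x‖ + t * ‖(Complex.I * β) • x - L x‖ := by
  have hn : ∀ s : ℝ, ‖Complex.exp (-(Complex.I * β) * s)‖ = 1 := fun s => by
    rw [Complex.norm_exp]; simp
  have hcont : ContinuousOn (fun s : ℝ => Complex.exp (-(Complex.I * β) * s) • T s x)
      (Icc 0 t) :=
    ContinuousOn.smul (by fun_prop) ((h.cont x).mono Icc_subset_Ici_self)
  have := norm_image_sub_le_of_norm_deriv_right_le_segment hcont
    (fun s hs => h.hasDerivWithinAt_exp_smul hs.1 hx (Complex.I * β))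
    (C := ‖(Complex.I * β) • x - L x‖) (fun s hs => by
      rw [norm_neg, norm_smul, hn, one_mul]; exact h.norm_apply_le hs.1 _) t ⟨ht, le_rfl⟩
  have e := norm_sub_norm_le (Complex.exp (-(Complex.I * β) * (0 : ℝ)) • T 0 x)
    (Complex.exp (-(Complex.I * β) * t) • T t x)
  rw [norm_sub_rev, norm_smul, norm_smul, hn, hn, one_mul, one_mul, h.zero,
    one_apply_eq_self] at e
  rw [h.zero, sub_zero, one_apply_eq_self] at this
  linarith

/-- The integrand of the Laplace transform of an orbit. -/
def lapIntegrand (T : ℝ → X →L[ℂ] X) (z : ℂ) (x : X) (t : ℝ) : X :=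
  Complex.exp (-z * t) • T t x

/-- The integrand of the Laplace transform of an orbit multiplied by time. -/
def lapTimeIntegrand (T : ℝ → X →L[ℂ] X) (z : ℂ) (x : X) (t : ℝ) : X :=
  t • lapIntegrand T z x t

theorem continuousOn_lapIntegrand (h : GeneratesContractions T D L) (z : ℂ) (x : X) :
    ContinuousOn (lapIntegrand T z x) (Ici 0) :=
  ContinuousOn.smul (by fun_prop) (h.cont x)

theorem continuousOn_lapTimeIntegrand (h : GeneratesContractions T D L) (z : ℂ) (x : X) :
    ContinuousOn (lapTimeIntegrand T z x) (Ici 0) :=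
  continuousOn_id.smul (h.continuousOn_lapIntegrand z x)

theorem norm_lapIntegrand_le (h : GeneratesContractions T D L) (z : ℂ) (x : X) {t : ℝ}
    (ht : 0 ≤ t) : ‖lapIntegrand T z x t‖ ≤ ‖x‖ * Real.exp (-z.re * t) := by
  rw [lapIntegrand, norm_smul, norm_exp_neg_mul, mul_comm]
  gcongr
  exact h.norm_apply_le ht x

theorem norm_lapTimeIntegrand_le (h : GeneratesContractions T D L) {z : ℂ} (hz : 0 < z.re)
    (x : X) {t : ℝ} (ht : 0 ≤ t) :
    ‖lapTimeIntegrand T z x t‖ ≤ 2 / z.re * ‖x‖ * Real.exp (-(z.re / 2) * t) := by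
  rw [lapTimeIntegrand, norm_smul, Real.norm_of_nonneg ht]
  have h1 := mul_le_mul_of_nonneg_left (h.norm_lapIntegrand_le z x ht) ht
  have h2 := mul_le_mul_of_nonneg_left (mul_exp_neg_le (t := t) hz) (norm_nonneg x)
  calc _ ≤ _ := h1
    _ = ‖x‖ * (t * Real.exp (-z.re * t)) := by ring
    _ ≤ _ := h2
    _ = _ := by ring

theorem integrableOn_lapIntegrand (h : GeneratesContractions T D L) {z : ℂ} (hz : 0 < z.re)
    (x : X) : IntegrableOn (lapIntegrand T z x) (Ioi 0) :=
  integrableOn_Ioi_of_exp_bound (h.continuousOn_lapIntegrand z x) hz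
    fun _ ht => h.norm_lapIntegrand_le z x ht

theorem integrableOn_lapTimeIntegrand (h : GeneratesContractions T D L) {z : ℂ} (hz : 0 < z.re)
    (x : X) : IntegrableOn (lapTimeIntegrand T z x) (Ioi 0) :=
  integrableOn_Ioi_of_exp_bound (h.continuousOn_lapTimeIntegrand z x) (half_pos hz)
    fun _ ht => h.norm_lapTimeIntegrand_le hz x ht

/-- The Laplace transform of an orbit. -/
def lap (T : ℝ → X →L[ℂ] X) (z : ℂ) (x : X) : X := ∫ t in Ioi 0, lapIntegrand T z x t

/-- The Laplace transform of an orbit multiplied by time. -/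
def lapTime (T : ℝ → X →L[ℂ] X) (z : ℂ) (x : X) : X := ∫ t in Ioi 0, lapTimeIntegrand T z x t

theorem norm_lap_le (h : GeneratesContractions T D L) {z : ℂ} (hz : 0 < z.re) (x : X) :
    z.re * ‖lap T z x‖ ≤ ‖x‖ := by
  have h1 : ‖lap T z x‖ ≤ ∫ t in Ioi 0, ‖x‖ * Real.exp (-z.re * t) :=
    norm_integral_le_of_norm_le ((integrableOn_exp_mul_Ioi (neg_lt_zero.2 hz) 0).const_mul _)
      ((ae_restrict_mem measurableSet_Ioi).mono
        fun t ht => h.norm_lapIntegrand_le z x (le_of_lt ht))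
  rw [integral_const_mul, integral_exp_mul_Ioi (neg_lt_zero.2 hz)] at h1
  simp only [mul_zero, Real.exp_zero] at h1
  calc z.re * ‖lap T z x‖ ≤ z.re * (‖x‖ * (-1 / -z.re)) := by gcongr
    _ = ‖x‖ := by field_simp

theorem lap_add (h : GeneratesContractions T D L) {z : ℂ} (hz : 0 < z.re) (x y : X) :
    lap T z (x + y) = lap T z x + lap T z y := by
  rw [lap, lap, lap, ← integral_add (h.integrableOn_lapIntegrand hz x)
    (h.integrableOn_lapIntegrand hz y)]
  simp only [lapIntegrand, map_add, smul_add]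

theorem lap_smul (z c : ℂ) (x : X) : lap T z (c • x) = c • lap T z x := by
  rw [lap, lap, ← integral_smul]
  simp only [lapIntegrand, map_smul, smul_comm c]

theorem lapTime_add (h : GeneratesContractions T D L) {z : ℂ} (hz : 0 < z.re) (x y : X) :
    lapTime T z (x + y) = lapTime T z x + lapTime T z y := by
  rw [lapTime, lapTime, lapTime, ← integral_add (h.integrableOn_lapTimeIntegrand hz x)
    (h.integrableOn_lapTimeIntegrand hz y)]
  simp only [lapTimeIntegrand, lapIntegrand, map_add, smul_add]

theorem lapTime_smul (z c : ℂ) (x : X) : lapTime T z (c • x) = c • lapTime T z x := by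
  rw [lapTime, lapTime, ← integral_smul]
  simp only [lapTimeIntegrand, lapIntegrand, map_smul, smul_comm c]

theorem fourier_indicator_lapIntegrand (ξ w : ℝ) (x : X) :
    𝓕 ((Ioi 0).indicator (lapIntegrand T ξ x)) w
      = lap T (ξ + Complex.I * (2 * Real.pi * w : ℝ)) x := by
  rw [Real.fourier_real_eq_integral_exp_smul, lap, ← integral_indicator measurableSet_Ioi]
  congr 1
  ext t
  by_cases ht : t ∈ Ioi (0 : ℝ)
  · simp only [indicator_of_mem ht, lapIntegrand, smul_smul, ← Complex.exp_add]
    congr 2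
    push_cast
    ring
  · simp [indicator_of_notMem ht]

theorem fourier_indicator_lapTimeIntegrand (ξ w : ℝ) (x : X) :
    𝓕 ((Ioi 0).indicator (lapTimeIntegrand T ξ x)) w
      = lapTime T (ξ + Complex.I * (2 * Real.pi * w : ℝ)) x := by
  rw [Real.fourier_real_eq_integral_exp_smul, lapTime, ← integral_indicator measurableSet_Ioi]
  congr 1
  ext t
  by_cases ht : t ∈ Ioi (0 : ℝ)
  · simp only [indicator_of_mem ht, lapTimeIntegrand, lapIntegrand,
      smul_comm _ t, smul_smul, ← Complex.exp_add]
    congr 3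
    push_cast
    ring
  · simp [indicator_of_notMem ht]

variable [CompleteSpace X]

theorem lap_apply_comm (h : GeneratesContractions T D L) {z : ℂ} (hz : 0 < z.re) {S : X →L[ℂ] X}
    (hS : ∀ t, 0 ≤ t → ∀ y, S (T t y) = T t (S y)) (x : X) :
    lap T z (S x) = S (lap T z x) := by
  rw [lap, lap, ← S.integral_comp_comm (h.integrableOn_lapIntegrand hz x)]
  refine setIntegral_congr_fun measurableSet_Ioi fun t ht => ?_
  simp only [lapIntegrand, map_smul, hS t (le_of_lt ht)]

theorem lapTime_apply_comm (h : GeneratesContractions T D L) {z : ℂ} (hz : 0 < z.re)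
    {S : X →L[ℂ] X} (hS : ∀ t, 0 ≤ t → ∀ y, S (T t y) = T t (S y)) (x : X) :
    lapTime T z (S x) = S (lapTime T z x) := by
  rw [lapTime, lapTime, ← S.integral_comp_comm (h.integrableOn_lapTimeIntegrand hz x)]
  refine setIntegral_congr_fun measurableSet_Ioi fun t ht => ?_
  simp only [lapTimeIntegrand, lapIntegrand, map_smul, ContinuousLinearMap.map_smul_of_tower,
    hS t (le_of_lt ht)]

theorem lap_generator (h : GeneratesContractions T D L) {z : ℂ} (hz : 0 < z.re) {x : X}
    (hx : x ∈ D) : lap T z (z • x - L x) = x := by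
  have h1 := integral_Ioi_of_hasDeriv_right (h.continuousOn_lapIntegrand z x)
    (u' := fun t => -lapIntegrand T z (z • x - L x) t)
    (fun t ht => (h.hasDerivWithinAt_exp_smul ht.le hx z).mono Ioi_subset_Ici_self)
    (h.integrableOn_lapIntegrand hz _).neg
    (tendsto_zero_of_exp_bound hz fun _ ht => h.norm_lapIntegrand_le z x ht)
  rw [integral_neg, neg_inj] at h1
  rw [lap, h1, lapIntegrand, h.zero]
  simp

theorem lapTime_generator (h : GeneratesContractions T D L) {z : ℂ} (hz : 0 < z.re) {x : X}
    (hx : x ∈ D) : lapTime T z (z • x - L x) = lap T z x := by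
  have h1 := integral_Ioi_of_hasDeriv_right (h.continuousOn_lapTimeIntegrand z x)
    (u' := fun t => lapIntegrand T z x t - lapTimeIntegrand T z (z • x - L x) t)
    (fun t ht => by
      have h2 := (hasDerivAt_id t).hasDerivWithinAt.smul
        ((h.hasDerivWithinAt_exp_smul ht.le hx z).mono Ioi_subset_Ici_self)
      refine h2.congr_deriv ?_
      simp only [id, smul_neg, one_smul, lapIntegrand, lapTimeIntegrand]
      abel)
    ((h.integrableOn_lapIntegrand hz _).sub (h.integrableOn_lapTimeIntegrand hz _))
    (tendsto_zero_of_exp_bound (half_pos hz) fun _ ht => h.norm_lapTimeIntegrand_le hz x ht)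
  rw [integral_sub (h.integrableOn_lapIntegrand hz _) (h.integrableOn_lapTimeIntegrand hz _),
    lapTimeIntegrand, zero_smul, neg_zero, sub_eq_zero] at h1
  exact h1.symm

/-- A bound for `S B` with `S` a resolvent on the imaginary axis controls the Laplace transform
of `t ↦ t T(t) B x` by that of the orbit of `x`. -/
theorem norm_lapTime_le (h : GeneratesContractions T D L) {ξ β : ℝ} (hξ : 0 < ξ)
    {S B : X →L[ℂ] X} (hS : IsResolventAt D L (Complex.I * β) S)
    (hB : ∀ t, 0 ≤ t → ∀ y, B (T t y) = T t (B y)) {K : ℝ} (hK : ‖S * B‖ ≤ K) (x : X) :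
    ‖lapTime T (ξ + Complex.I * β) (B x)‖ ≤ 2 * K * ‖lap T (ξ + Complex.I * β) x‖ := by
  set z : ℂ := ξ + Complex.I * β with hz
  have hre : z.re = ξ := by simp [hz]
  have hpos : 0 < z.re := hre ▸ hξ
  have hgen : ∀ y, z • S y - L (S y) = y + (ξ : ℂ) • S y := fun y => by
    nth_rewrite 3 [← hS.2.1 y]
    rw [hz]
    module
  have hST : ∀ t, 0 ≤ t → ∀ y, S (T t y) = T t (S y) := fun t ht y =>
    h.resolvent_apply ht hS y
  have hlap : ∀ y, lap T z y + (ξ : ℂ) • lap T z (S y) = S y := fun y => by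
    rw [← lap_smul, ← h.lap_add hpos, ← hgen, h.lap_generator hpos (hS.1 y)]
  set F := lap T z x with hF
  set G := lapTime T z (B x) with hG
  have hGF : G + (ξ : ℂ) • S G = S (B F) := by
    rw [hG, ← h.lapTime_apply_comm hpos hST, ← lapTime_smul, ← h.lapTime_add hpos, ← hgen,
      h.lapTime_generator hpos (hS.1 _), h.lap_apply_comm hpos hST, h.lap_apply_comm hpos hB]
  have hSG : lap T z (S (B F)) = S G := by
    rw [← hGF, h.lap_add hpos, lap_smul, hlap]
  have hGe : G = S (B F) - (ξ : ℂ) • lap T z (S (B F)) := by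
    rw [hSG, ← hGF, add_sub_cancel_right]
  have hb : ‖S (B F)‖ ≤ K * ‖F‖ := (S * B).le_of_opNorm_le hK F
  have h1 := h.norm_lap_le hpos (S (B F))
  rw [hGe]
  refine (norm_sub_le _ _).trans ?_
  rw [norm_smul, Complex.norm_real, Real.norm_of_nonneg hξ.le, ← hre]
  linarith

theorem norm_apply_le_inv_of_bound (h : GeneratesContractions T D L) {R : ℝ → X →L[ℂ] X}
    (hR : ∀ β : ℝ, IsResolventAt D L (Complex.I * β) (R β)) {B : X →L[ℂ] X}
    (hB : ∀ t, 0 ≤ t → ∀ y, B (T t y) = T t (B y)) {K : ℝ} (hK0 : 0 ≤ K)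
    (hK : ∀ β, ‖R β * B‖ ≤ K) {t : ℝ} (ht : 0 < t) (x : X) :
    ‖T t (B x)‖ ≤ 12 * K * t⁻¹ * ‖x‖ := by
  set ξ := t⁻¹ with hξ
  have hξ0 : 0 < ξ := inv_pos.2 ht
  have hre : 0 < (ξ : ℂ).re := hξ0
  set f := (Ioi 0).indicator (lapIntegrand T ξ x)
  set g := (Ioi 0).indicator (lapTimeIntegrand T ξ (B x)) with hg
  have hf2 : MemLp f 2 := memLp_two_indicator_Ioi_of_exp_bound (h.continuousOn_lapIntegrand _ x) hre
    fun _ hs => h.norm_lapIntegrand_le _ x hs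
  have hg2 : MemLp g 2 := memLp_two_indicator_Ioi_of_exp_bound
    (h.continuousOn_lapTimeIntegrand _ (B x)) (half_pos hre)
    fun _ hs => h.norm_lapTimeIntegrand_le hre (B x) hs
  have hle : ∫ s, ‖g s‖ ^ 2 ≤ (2 * K) ^ 2 * ∫ s, ‖f s‖ ^ 2 := by
    refine integral_norm_sq_le_of_fourier_le
      ((integrable_indicator_iff measurableSet_Ioi).2 (h.integrableOn_lapIntegrand hre x)) hf2
      ((integrable_indicator_iff measurableSet_Ioi).2
        (h.integrableOn_lapTimeIntegrand hre (B x))) hg2 fun w => ?_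
    rw [fourier_indicator_lapIntegrand, fourier_indicator_lapTimeIntegrand]
    exact h.norm_lapTime_le hξ0 (hR _) hB (hK _) x
  have hfle : ∫ s, ‖f s‖ ^ 2 ≤ ‖x‖ ^ 2 * (t / 2) := by
    have hneg : -(2 * ξ) < 0 := by linarith
    have h1 : ∫ s, ‖f s‖ ^ 2 ≤ ∫ s, (Ioi 0).indicator
        (fun s => ‖x‖ ^ 2 * Real.exp (-(2 * ξ) * s)) s := by
      refine integral_mono_of_nonneg (.of_forall fun s => by positivity)
        ((integrable_indicator_iff measurableSet_Ioi).2
          ((integrableOn_exp_mul_Ioi hneg 0).const_mul _)) (.of_forall fun s => ?_)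
      by_cases hs : s ∈ Ioi (0 : ℝ)
      · simp only [f, indicator_of_mem hs]
        refine (pow_le_pow_left₀ (norm_nonneg _)
          (h.norm_lapIntegrand_le (ξ : ℂ) x (le_of_lt hs)) 2).trans_eq ?_
        rw [mul_pow, ← Real.exp_nat_mul, Complex.ofReal_re]
        congr 2
        push_cast
        ring
      · simp [f, indicator_of_notMem hs]
    rw [integral_indicator measurableSet_Ioi, integral_const_mul, integral_exp_mul_Ioi hneg] at h1
    refine h1.trans_eq ?_
    simp only [mul_zero, Real.exp_zero, hξ]
    field_simp
  have hgge : (t / 2) * (t / 2 * Real.exp (-1) * ‖T t (B x)‖) ^ 2 ≤ ∫ s, ‖g s‖ ^ 2 := by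
    have h1 : ∫ s, (Ioc (t / 2) t).indicator
        (fun _ => (t / 2 * Real.exp (-1) * ‖T t (B x)‖) ^ 2) s ≤ ∫ s, ‖g s‖ ^ 2 := by
      refine integral_mono_of_nonneg
        (.of_forall fun s => indicator_nonneg (fun _ _ => by positivity) s)
        ((memLp_two_iff_integrable_sq_norm hg2.1).1 hg2) (.of_forall fun s => ?_)
      by_cases hs : s ∈ Ioc (t / 2) t
      · have hs0 : 0 < s := (half_pos ht).trans hs.1
        simp only [indicator_of_mem hs, hg, indicator_of_mem (mem_Ioi.2 hs0)]
        rw [lapTimeIntegrand, lapIntegrand, norm_smul, norm_smul, norm_exp_neg_mul,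
          Real.norm_of_nonneg hs0.le, ← mul_assoc]
        gcongr
        · exact hs.1.le
        · rw [Complex.ofReal_re, hξ, neg_mul, neg_le_neg_iff, inv_mul_le_iff₀ ht, mul_one]
          exact hs.2
        · exact h.norm_apply_anti hs0.le hs.2 _
      · rw [indicator_of_notMem hs]; positivity
    rw [integral_indicator measurableSet_Ioc, setIntegral_const] at h1
    refine le_trans (le_of_eq ?_) h1
    rw [Measure.real, Real.volume_Ioc, ENNReal.toReal_ofReal (by linarith), smul_eq_mul]
    ring
  have hsq : (t / 2 * Real.exp (-1) * ‖T t (B x)‖) ^ 2 ≤ (2 * K * ‖x‖) ^ 2 := by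
    refine le_of_mul_le_mul_left ?_ (half_pos ht)
    have := mul_le_mul_of_nonneg_left hfle (sq_nonneg (2 * K))
    calc _ ≤ _ := hgge.trans (hle.trans this)
      _ = _ := by ring
  have h3 := (pow_le_pow_iff_left₀ (by positivity) (by positivity) two_ne_zero).1 hsq
  have he : 1 / 3 ≤ Real.exp (-1) := by
    rw [Real.exp_neg, one_div]
    exact inv_anti₀ (Real.exp_pos _) (Real.exp_one_lt_d9.le.trans (by norm_num))
  have h4 : t / 2 * (1 / 3) * ‖T t (B x)‖ ≤ 2 * K * ‖x‖ := le_trans (by gcongr) h3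
  rw [show 12 * K * ξ * ‖x‖ = (12 * K * ‖x‖) / t by rw [hξ]; ring, le_div_iff₀ ht]
  linarith

end GeneratesContractions

theorem pow_apply_pow_generator {X : Type*} [NormedAddCommGroup X] [InnerProductSpace ℂ X]
    {D : Submodule ℂ X} {L : X →ₗ[ℂ] X} {S : X →L[ℂ] X} (hS : IsResolventAt D L 0 S) (k : ℕ)
    {x : X} (hx : ∀ j < k, (L ^ j) x ∈ D) : (S ^ k) ((L ^ k) x) = (-1 : ℂ) ^ k • x := by
  induction k with
  | zero => simp
  | succ k ih =>
    have h1 := hS.2.2 _ (hx k k.lt_succ_self)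
    rw [zero_smul, zero_sub, map_neg, neg_eq_iff_eq_neg] at h1
    rw [pow_succ S, pow_succ' L, mul_apply_eq_comp, Module.End.mul_apply, h1, map_neg,
      ih fun j hj => hx j (hj.trans k.lt_succ_self), pow_succ]
    module

/-- **Borichev–Tomilov.** For the generator `L` (with domain `D`) of a
`C₀`-semigroup of contractions on a Hilbert space such that `iℝ ⊆ ρ(L)` (with resolvent
`R β = (iβ - L)⁻¹`), and a positive integer `l`, the polynomial decay estimates
`‖e^{tL}U₀‖ ≤ C t^{-1/l} ‖U₀‖_{D(L)}` and `‖e^{tL}U₀‖ ≤ C t⁻¹ ‖U₀‖_{D(L^l)}` for `t > 1`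
hold if and only if `limsup_{|β|→∞} β^{-l} ‖(iβ - L)⁻¹‖ < ∞`. -/
theorem borichev_tomilov
    (X : Type*) [NormedAddCommGroup X] [InnerProductSpace ℂ X] [CompleteSpace X]
    -- contraction `C₀`-semigroup
    (T : ℝ → X →L[ℂ] X)
    (hT0 : T 0 = 1)
    (hTsemi : ∀ s t : ℝ, 0 ≤ s → 0 ≤ t → T (s + t) = T s ∘L T t)
    (hTcont : ∀ x : X, ContinuousOn (fun t => T t x) (Ici 0))
    (hTcontr : ∀ t : ℝ, 0 ≤ t → ‖T t‖ ≤ 1)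
    -- generator `L` with domain `D`
    (D : Submodule ℂ X) (L : X →ₗ[ℂ] X)
    (hgen : ∀ x ∈ D, HasDerivWithinAt (fun t => T t x) (L x) (Ici 0) 0)
    (hdom : ∀ x : X, (∃ y : X, HasDerivWithinAt (fun t => T t x) y (Ici 0) 0) → x ∈ D)
    -- `iℝ ⊆ ρ(L)`, with resolvent `R β = (iβ - L)⁻¹`
    (R : ℝ → X →L[ℂ] X)
    (hR : ∀ β : ℝ, (∀ y : X, R β y ∈ D) ∧
      (∀ y : X, (Complex.I * β) • R β y - L (R β y) = y) ∧
      (∀ x ∈ D, R β ((Complex.I * β) • x - L x) = x))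
    (l : ℕ) (hl : 0 < l) :
    (∃ C : ℝ, 0 < C ∧
        (∀ U₀ ∈ D, ∀ t : ℝ, 1 < t →
          ‖T t U₀‖ ≤ C * t ^ (-(1 : ℝ) / l) * (‖U₀‖ + ‖L U₀‖)) ∧
        (∀ U₀ : X, (∀ k : ℕ, k < l → (L ^ k) U₀ ∈ D) → ∀ t : ℝ, 1 < t →
          ‖T t U₀‖ ≤ C * t⁻¹ * (‖U₀‖ + ‖(L ^ l) U₀‖))) ↔
      (∃ M β₀ : ℝ, 0 < M ∧ 0 < β₀ ∧ ∀ β : ℝ, β₀ ≤ |β| → ‖R β‖ ≤ M * |β| ^ l) := by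
  have h : GeneratesContractions T D L := ⟨hT0, hTsemi, hTcont, hTcontr, hgen, hdom⟩
  have hR' : ∀ β : ℝ, IsResolventAt D L (Complex.I * β) (R β) := hR
  have hl0 : (l : ℝ) ≠ 0 := Nat.cast_ne_zero.2 hl.ne'
  constructor
  · rintro ⟨C, hC, hdecay, -⟩
    set C' := max C 1
    have hC' : 1 ≤ C' := le_max_right _ _
    refine ⟨3 * (4 * C') ^ l, 1, by positivity, one_pos, fun β hβ => ?_⟩
    refine ContinuousLinearMap.opNorm_le_bound _ (by positivity) fun y => ?_
    set a := 4 * C' * |β| with ha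
    have ha4 : 4 ≤ a := by nlinarith
    have ha0 : 0 < a := by linarith
    have ht : 1 < a ^ l := one_lt_pow₀ (by linarith) hl.ne'
    have hat : (a ^ l) ^ (-(1 : ℝ) / l) = a⁻¹ := by
      rw [← Real.rpow_natCast, ← Real.rpow_mul ha0.le, mul_div_cancel₀ _ hl0, Real.rpow_neg_one]
    set x := R β y with hx
    have hres : (Complex.I * β) • x - L x = y := (hR β).2.1 y
    have h1 := h.norm_le_of_decay (zero_le_one.trans ht.le) ((hR β).1 y) β
    have h2 := hdecay x ((hR β).1 y) _ ht
    rw [← hx, hres] at h1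
    have hLx : ‖L x‖ ≤ |β| * ‖x‖ + ‖y‖ := by
      have e : L x = (Complex.I * β) • x - y := by rw [← hres]; abel
      rw [e]
      refine (norm_sub_le _ _).trans_eq ?_
      rw [norm_smul, norm_mul, Complex.norm_I, one_mul, Complex.norm_real, Real.norm_eq_abs]
    have hCa : C * a⁻¹ ≤ (4 * |β|)⁻¹ := by
      rw [← div_eq_mul_inv, div_le_iff₀ ha0, ha, inv_mul_eq_div, le_div_iff₀ (by positivity)]
      nlinarith [le_max_left C 1]
    rw [hat] at h2
    have h3 : ‖T (a ^ l) x‖ ≤ (4 * |β|)⁻¹ * (2 * |β| * ‖x‖ + |β| * ‖y‖) := by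
      refine h2.trans (mul_le_mul hCa ?_ (by positivity) (by positivity))
      have := mul_le_mul_of_nonneg_right hβ (norm_nonneg x)
      have := mul_le_mul_of_nonneg_right hβ (norm_nonneg y)
      linarith
    have hβ0 : |β| ≠ 0 := by positivity
    have h4 : (4 * |β|)⁻¹ * (2 * |β| * ‖x‖ + |β| * ‖y‖) = ‖x‖ / 2 + ‖y‖ / 4 := by
      field_simp
      ring
    have h5 := mul_le_mul_of_nonneg_right ht.le (norm_nonneg y)
    have h6 : 3 * (4 * C') ^ l * |β| ^ l * ‖y‖ = 3 * (a ^ l * ‖y‖) := by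
      rw [mul_assoc 3, ← mul_pow, ← ha, mul_assoc]
    rw [h4] at h3
    rw [h6]
    linarith [norm_nonneg y]
  · rintro ⟨M, β₀, -, -, hM⟩
    obtain ⟨K, hK0, hK⟩ := exists_bound_resolvent_mul_pow hR' hM
    have hS : IsResolventAt D L 0 (R 0) := by simpa using hR' 0
    obtain ⟨c, hc, hpow⟩ := exists_norm_pow_le_of_accretive
      (fun y => h.re_inner_resolvent_nonneg hS y) (l - 1)
    rw [Nat.sub_add_cancel hl] at hpow
    have hmain : ∀ t : ℝ, 0 < t → ∀ x, ‖T t ((R 0 ^ l) x)‖ ≤ 12 * K * t⁻¹ * ‖x‖ :=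
      fun t ht x => h.norm_apply_le_inv_of_bound hR'
        (fun s hs y => h.pow_apply hs hS l y) hK0.le hK ht x
    set A := c * (12 * K)
    have hA : 0 < A := by positivity
    refine ⟨A ^ (1 / l : ℝ) + 12 * K, by positivity, fun U₀ hU t ht => ?_, fun U₀ hU t ht => ?_⟩
    · have ht0 : 0 < t := one_pos.trans ht
      have e : R 0 (T t (L U₀)) = -T t U₀ := by
        have h1 := hS.2.2 _ hU
        rw [zero_smul, zero_sub, map_neg, neg_eq_iff_eq_neg] at h1
        rw [h.resolvent_apply ht0.le hS, h1, map_neg]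
      have h1 := hpow (T t (L U₀))
      rw [e, norm_neg, h.pow_apply ht0.le hS] at h1
      have h2 : ‖T t U₀‖ ^ l ≤ (A ^ (1 / l : ℝ) * t ^ (-(1 : ℝ) / l) * ‖L U₀‖) ^ l := by
        rw [mul_pow, mul_pow, ← Real.rpow_mul_natCast hA.le, ← Real.rpow_mul_natCast ht0.le,
          div_mul_cancel₀ _ hl0, div_mul_cancel₀ _ hl0, Real.rpow_one, Real.rpow_neg_one]
        calc _ ≤ _ := h1
          _ ≤ c * ‖L U₀‖ ^ (l - 1) * (12 * K * t⁻¹ * ‖L U₀‖) := by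
            gcongr
            · exact h.norm_apply_le ht0.le _
            · exact hmain t ht0 _
          _ = A * t⁻¹ * (‖L U₀‖ ^ (l - 1) * ‖L U₀‖) := by ring
          _ = _ := by rw [pow_sub_one_mul hl.ne']
      have h3 := (pow_le_pow_iff_left₀ (norm_nonneg _) (by positivity) hl.ne').1 h2
      refine h3.trans ?_
      gcongr
      · linarith
      · linarith [norm_nonneg U₀]
    · have ht0 : 0 < t := one_pos.trans ht
      have h1 := hmain t ht0 ((L ^ l) U₀)
      rw [pow_apply_pow_generator hS l hU, map_smul, norm_smul, norm_pow, norm_neg, norm_one,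
        one_pow, one_mul] at h1
      refine h1.trans ?_
      gcongr
      · linarith [Real.rpow_nonneg hA.le (1 / l : ℝ)]
      · linarith [norm_nonneg U₀]
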